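/- Under the density ρ_d with uniform weights p_i = 1/(d+1), the random variable Y_p = −p + (d+1)Σ_{i=1}^p (1/x_i)/(Σ_{k=1}^{d+1} 1/x_k) satisfies ∫_{Δ_d} Y_p(x)^2 ρ_d(x)dx = 2p(d+1−p)/(d+3) for each 1 ≤ p ≤ d. -/

import Mathlib

open MeasureTheory Set

/-- The standard `d`-simplex in `ℝ^d`. -/
def simplexDelta (d : ℕ) : Set (Fin d → ℝ) :=
  {x | (∀ i, 0 ≤ x i) ∧ ∑ i, x i ≤ 1}

/-- Extend `x ∈ Δ_d` by the last barycentric coordinate `x_{d+1} = 1 - Σ x_i`. -/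
noncomputable def extCoord {d : ℕ} (x : Fin d → ℝ) : Fin (d + 1) → ℝ :=
  Fin.snoc x (1 - ∑ i, x i)

/-- The density on `Δ_d` of the projection of the `Dirichlet(1/2, θ, ν₀)` process,
with weights `p : Fin (d+1) → ℝ`. -/
noncomputable def rhoD (d : ℕ) (θ : ℝ) (p : Fin (d + 1) → ℝ) (x : Fin d → ℝ) : ℝ :=
  ((∏ j, p j) * Real.Gamma (θ + ((d : ℝ) + 1) / 2) /
      (Real.pi ^ ((d : ℝ) / 2) * Real.Gamma (θ + 1 / 2))) *
    (∏ j, extCoord x j ^ (-(3 : ℝ) / 2)) /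
    (∑ j, (p j) ^ 2 / extCoord x j) ^ (θ + ((d : ℝ) + 1) / 2)

open scoped ENNReal

lemma aux_oneDim (a S : ℝ) (ha : 0 < a) (hS : 0 < S) :
    ∫ r in Ioi (0:ℝ), r ^ (-1 - a) * Real.exp (-(S / r)) = (1 / S) ^ a * Real.Gamma a := by
  rw [← Real.integral_rpow_mul_exp_neg_mul_Ioi ha hS,
    ← integral_comp_rpow_Ioi (fun t => t ^ (a - 1) * Real.exp (-(S * t))) (p := -1) (by norm_num)]
  refine setIntegral_congr_fun measurableSet_Ioi (fun r hr => ?_)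
  have hr : 0 < r := hr
  simp only [smul_eq_mul, abs_neg, abs_one, one_mul]
  rw [← Real.rpow_mul hr.le, ← mul_assoc, ← Real.rpow_add hr, Real.rpow_neg_one, div_eq_mul_inv]
  congr 2
  ring

lemma aux_oneDim_int (a S : ℝ) (ha : 0 < a) (hS : 0 < S) :
    IntegrableOn (fun r : ℝ => r ^ (-1 - a) * Real.exp (-(S / r))) (Ioi 0) := by
  apply Integrable.of_integral_ne_zero
  rw [aux_oneDim a S ha hS]
  have := Real.Gamma_pos_of_pos ha
  positivity

lemma aux_lint (a S : ℝ) (ha : 0 < a) (hS : 0 < S) :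
    ∫⁻ r in Ioi (0:ℝ), ENNReal.ofReal (r⁻¹) * ENNReal.ofReal ((S / r) ^ a * Real.exp (-(S / r)))
      = ENNReal.ofReal (Real.Gamma a) := by
  have h1 : ∀ r ∈ Ioi (0:ℝ),
      ENNReal.ofReal (r⁻¹) * ENNReal.ofReal ((S / r) ^ a * Real.exp (-(S / r)))
      = ENNReal.ofReal (S ^ a * (r ^ (-1 - a) * Real.exp (-(S / r)))) := by
    intro r hr
    have hr : 0 < r := hr
    rw [← ENNReal.ofReal_mul (by positivity)]
    congr 1
    rw [Real.div_rpow hS.le hr.le, sub_eq_add_neg, Real.rpow_add hr, Real.rpow_neg_one,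
      Real.rpow_neg hr.le]
    ring
  rw [setLIntegral_congr_fun measurableSet_Ioi h1,
    ← ofReal_integral_eq_lintegral_ofReal ((aux_oneDim_int a S ha hS).const_mul _),
    integral_const_mul, aux_oneDim a S ha hS, ← mul_assoc, ← Real.mul_rpow hS.le (by positivity)]
  · simp [hS.ne']
  · refine (ae_restrict_iff' measurableSet_Ioi).2 (Filter.Eventually.of_forall fun r hr => ?_)
    have hr : 0 < r := hr
    simp only [Pi.zero_apply]
    positivity

lemma aux_meas_ext (d : ℕ) : Measurable (fun q : (Fin d → ℝ) × ℝ =>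
    (Fin.snoc q.1 q.2 : Fin (d + 1) → ℝ)) := by
  refine measurable_pi_iff.2 fun i => ?_
  refine Fin.lastCases ?_ (fun j => ?_) i
  · simpa using measurable_snd
  · simp only [Fin.snoc_castSucc]
    fun_prop

lemma aux_split (d : ℕ) (H : (Fin (d + 1) → ℝ) → ℝ≥0∞) (hH : Measurable H) :
    ∫⁻ t, H t = ∫⁻ y : Fin d → ℝ, ∫⁻ s : ℝ, H (Fin.snoc y s) := by
  have h := (volume_preserving_piFinSuccAbove (fun _ : Fin (d + 1) => ℝ) (Fin.last d)).symm
  rw [← h.lintegral_comp hH]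
  have hm : Measurable fun q : ℝ × (Fin d → ℝ) => H (Fin.snoc q.2 q.1) :=
    hH.comp ((aux_meas_ext d).comp measurable_swap)
  rw [← lintegral_prod_symm' (fun q : ℝ × (Fin d → ℝ) => H (Fin.snoc q.2 q.1)) hm]
  rw [← Measure.volume_eq_prod]
  have e : ∀ q : ℝ × (Fin d → ℝ), (MeasurableEquiv.piFinSuccAbove (fun _ : Fin (d + 1) => ℝ)
      (Fin.last d)).symm q = Fin.snoc q.2 q.1 := by
    intro q
    exact Fin.insertNth_last (α := fun _ => ℝ) q.1 q.2
  have e2 : ∀ q : ℝ × (Fin d → ℝ), H ((MeasurableEquiv.piFinSuccAbove (fun _ : Fin (d + 1) => ℝ)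
      (Fin.last d)).symm q) = H (Fin.snoc q.2 q.1) := fun q => by rw [e]
  exact lintegral_congr e2

lemma aux_scale (d : ℕ) (F : (Fin d → ℝ) → ℝ≥0∞) (r : ℝ) (hr : 0 < r) :
    ∫⁻ y, F y = ENNReal.ofReal (r ^ d) * ∫⁻ x, F (r • x) := by
  have e := (Homeomorph.smulOfNeZero (α := Fin d → ℝ) r hr.ne').toMeasurableEquiv
  have h : ∫⁻ x, F (r • x) = ∫⁻ y, F y ∂(Measure.map (r • ·) volume) :=
    (lintegral_map_equiv F (Homeomorph.smulOfNeZero (α := Fin d → ℝ) r hr.ne').toMeasurableEquiv).symm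
  rw [h, Measure.map_addHaar_smul _ hr.ne', lintegral_smul_measure, smul_eq_mul, ← mul_assoc,
    ← ENNReal.ofReal_mul (by positivity), Module.finrank_fin_fun, abs_of_pos (by positivity),
    mul_inv_cancel₀ (by positivity), ENNReal.ofReal_one, one_mul]

lemma aux_snoc_smul {d : ℕ} (r : ℝ) (x : Fin d → ℝ) :
    (Fin.snoc (r • x) (r - ∑ i, (r • x) i) : Fin (d + 1) → ℝ) = r • extCoord x := by
  funext i
  refine Fin.lastCases ?_ (fun j => ?_) i
  · simp [extCoord, ← Finset.mul_sum]; ring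
  · simp [extCoord]

lemma aux_sum_ext {d : ℕ} (x : Fin d → ℝ) : ∑ i, extCoord x i = 1 := by
  simp [extCoord, Fin.sum_univ_castSucc]

lemma aux_meas_extCoord (d : ℕ) : Measurable (extCoord : (Fin d → ℝ) → Fin (d + 1) → ℝ) :=
  (aux_meas_ext d).comp (f := fun x : Fin d → ℝ => (x, 1 - ∑ i, x i)) (by fun_prop)

lemma aux_polar (d : ℕ) (G : (Fin (d + 1) → ℝ) → ℝ≥0∞) (hG : Measurable G)
    (h0 : ∀ t, (∃ i, t i ≤ 0) → G t = 0)
    (hom : ∀ r : ℝ, 0 < r → ∀ t, ENNReal.ofReal (r ^ d) * G (r • t) = ENNReal.ofReal r⁻¹ * G t)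
    (a : ℝ) (ha : 0 < a) :
    ∫⁻ t, G t * ENNReal.ofReal ((∑ i, 1 / t i) ^ a * Real.exp (-(∑ i, 1 / t i)))
      = ENNReal.ofReal (Real.Gamma a) * ∫⁻ x, G (extCoord x) := by
  set S : (Fin (d + 1) → ℝ) → ℝ := fun t => ∑ i, 1 / t i with hSdef
  have hS : Measurable S := by fun_prop
  set H : (Fin (d + 1) → ℝ) → ℝ≥0∞ :=
    fun t => G t * ENNReal.ofReal ((S t) ^ a * Real.exp (-(S t))) with hHdef
  have hH : Measurable H := by fun_prop
  have hH0 : ∀ t, (∃ i, t i ≤ 0) → H t = 0 := fun t ht => by simp [hHdef, h0 t ht]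
  have hSr : ∀ r t, S (r • t) = S t / r := by
    intro r t
    simp only [hSdef, Pi.smul_apply, smul_eq_mul, Finset.sum_div]
    exact Finset.sum_congr rfl fun i _ => by rw [div_div, mul_comm]
  have hmeas2 : Measurable fun q : (Fin d → ℝ) × ℝ => H (Fin.snoc q.1 (q.2 - ∑ i, q.1 i)) :=
    hH.comp ((aux_meas_ext d).comp
      (f := fun q : (Fin d → ℝ) × ℝ => (q.1, q.2 - ∑ i, q.1 i)) (by fun_prop))
  calc ∫⁻ t, H t = ∫⁻ y : Fin d → ℝ, ∫⁻ s : ℝ, H (Fin.snoc y s) := aux_split d H hH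
    _ = ∫⁻ y : Fin d → ℝ, ∫⁻ r : ℝ, H (Fin.snoc y (r - ∑ i, y i)) := by
        refine lintegral_congr fun y => ?_
        exact (lintegral_sub_right_eq_self (fun s => H (Fin.snoc y s)) (∑ i, y i)).symm
    _ = ∫⁻ r : ℝ, ∫⁻ y : Fin d → ℝ, H (Fin.snoc y (r - ∑ i, y i)) :=
        lintegral_lintegral_swap hmeas2.aemeasurable
    _ = ∫⁻ r in Ioi (0:ℝ), ∫⁻ y : Fin d → ℝ, H (Fin.snoc y (r - ∑ i, y i)) := by
        rw [← lintegral_indicator measurableSet_Ioi]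
        refine lintegral_congr fun r => ?_
        by_cases hr : 0 < r
        · rw [indicator_of_mem (by exact hr)]
        · rw [indicator_of_notMem (by exact hr)]
          rw [lintegral_eq_zero_iff' (by
            exact (hmeas2.comp (measurable_prodMk_right (y := r))).aemeasurable)]
          refine Filter.Eventually.of_forall fun y => ?_
          apply hH0
          by_contra hcon
          push Not at hcon
          have h1 : 0 < ∑ i, (Fin.snoc y (r - ∑ i, y i) : Fin (d + 1) → ℝ) i :=
            Finset.sum_pos (fun i _ => hcon i) Finset.univ_nonempty
          rw [Fin.sum_univ_castSucc] at h1
          simp at h1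
          exact hr h1
    _ = ∫⁻ r in Ioi (0:ℝ), ∫⁻ x : Fin d → ℝ, G (extCoord x) * (ENNReal.ofReal r⁻¹ *
          ENNReal.ofReal ((S (extCoord x) / r) ^ a * Real.exp (-(S (extCoord x) / r)))) := by
        refine setLIntegral_congr_fun measurableSet_Ioi fun r hr => ?_
        have hr : 0 < r := hr
        rw [aux_scale d _ r hr, ← lintegral_const_mul]
        · refine lintegral_congr fun x => ?_
          rw [aux_snoc_smul]
          simp only [hHdef]
          rw [hSr, ← mul_assoc, hom r hr, mul_comm (ENNReal.ofReal r⁻¹), mul_assoc]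
        · exact hmeas2.comp (f := fun x : Fin d → ℝ => (r • x, r)) (by fun_prop)
    _ = ∫⁻ x : Fin d → ℝ, ∫⁻ r in Ioi (0:ℝ), G (extCoord x) * (ENNReal.ofReal r⁻¹ *
          ENNReal.ofReal ((S (extCoord x) / r) ^ a * Real.exp (-(S (extCoord x) / r)))) := by
        refine lintegral_lintegral_swap (Measurable.aemeasurable ?_)
        have h1 : Measurable fun q : ℝ × (Fin d → ℝ) => G (extCoord q.2) :=
          hG.comp ((aux_meas_extCoord d).comp measurable_snd)
        have h2 : Measurable fun q : ℝ × (Fin d → ℝ) => S (extCoord q.2) :=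
          hS.comp ((aux_meas_extCoord d).comp measurable_snd)
        have h3 : Measurable fun q : ℝ × (Fin d → ℝ) => S (extCoord q.2) / q.1 :=
          h2.div measurable_fst
        exact h1.mul (measurable_fst.inv.ennreal_ofReal.mul
          ((h3.pow_const a).mul (Real.measurable_exp.comp h3.neg)).ennreal_ofReal)
    _ = ∫⁻ x : Fin d → ℝ, ENNReal.ofReal (Real.Gamma a) * G (extCoord x) := by
        refine lintegral_congr fun x => ?_
        by_cases hx : ∃ i, extCoord x i ≤ 0
        · simp [h0 _ hx]
        · push Not at hx
          have hpos : 0 < S (extCoord x) :=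
            Finset.sum_pos (fun i _ => by have := hx i; positivity) Finset.univ_nonempty
          rw [lintegral_const_mul _ (by fun_prop), aux_lint a _ ha hpos, mul_comm]
    _ = _ := lintegral_const_mul _ (hG.comp (aux_meas_extCoord d))

noncomputable def auxF (m : ℕ) : ℝ → ℝ :=
  (Ioi (0:ℝ)).indicator fun t => t ^ (-1 - (1 / 2 + (m : ℝ))) * Real.exp (-(1 / t))

lemma auxF_int (m : ℕ) : Integrable (auxF m) :=
  (integrable_indicator_iff measurableSet_Ioi).2 (aux_oneDim_int _ 1 (by positivity) one_pos)

lemma auxF_integral (m : ℕ) : ∫ t, auxF m t = Real.Gamma (1 / 2 + m) := by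
  unfold auxF
  rw [integral_indicator measurableSet_Ioi, aux_oneDim _ 1 (by positivity) one_pos]
  simp

lemma auxF_nonneg (m : ℕ) (t : ℝ) : 0 ≤ auxF m t := by
  unfold auxF
  refine indicator_nonneg (fun r hr => ?_) t
  have hr : 0 < r := hr
  positivity

lemma auxF_mul (m : ℕ) (t : ℝ) : auxF m t = (1 / t) ^ m * auxF 0 t := by
  unfold auxF
  by_cases ht : t ∈ Ioi (0:ℝ)
  · rw [indicator_of_mem ht, indicator_of_mem ht]
    have ht : 0 < t := ht
    rw [show (-1 - (1 / 2 + (m : ℝ))) = -(m : ℝ) + (-1 - (1 / 2 + ((0 : ℕ) : ℝ))) by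
      push_cast; ring, Real.rpow_add ht, Real.rpow_neg ht.le, Real.rpow_natCast, mul_assoc,
      one_div_pow, one_div (t ^ m)]
  · rw [indicator_of_notMem ht, indicator_of_notMem ht, mul_zero]

def auxE {n : ℕ} (i j k : Fin n) : ℕ := (if k = i then 1 else 0) + (if k = j then 1 else 0)

lemma auxE_prod {n : ℕ} (i j : Fin n) (t : Fin n → ℝ) :
    ∏ k, auxF (auxE i j k) (t k) = (1 / t i) * (1 / t j) * ∏ k, auxF 0 (t k) := by
  have h : ∀ k, auxF (auxE i j k) (t k) =
      ((if k = i then 1 / t k else 1) * (if k = j then 1 / t k else 1)) * auxF 0 (t k) := by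
    intro k
    rw [auxF_mul, auxE, pow_add]
    congr 2
    · split_ifs <;> simp
    · split_ifs <;> simp
  simp_rw [h, Finset.prod_mul_distrib]
  simp

lemma auxGamma (m : ℕ) (hm : m ≤ 2) : Real.Gamma (1 / 2 + m) =
    √Real.pi * (if m = 0 then 1 else if m = 1 then 1 / 2 else 3 / 4) := by
  have h1 : Real.Gamma (1 / 2 + 1) = √Real.pi * (1 / 2) := by
    rw [Real.Gamma_add_one (by norm_num), Real.Gamma_one_half_eq, mul_comm]
  have h2 : Real.Gamma (1 / 2 + 2) = √Real.pi * (3 / 4) := by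
    rw [show (1 / 2 + 2 : ℝ) = (1 / 2 + 1) + 1 by norm_num, Real.Gamma_add_one (by norm_num), h1]
    ring
  interval_cases m
  · simpa using Real.Gamma_one_half_eq
  · simpa using h1
  · simpa using h2

lemma auxE_integral {n : ℕ} (i j : Fin n) :
    ∫ t : Fin n → ℝ, ∏ k, auxF (auxE i j k) (t k)
      = √Real.pi ^ n * (1 / 4 + if i = j then 1 / 2 else 0) := by
  rw [integral_fintype_prod_volume_eq_prod (fun k => auxF (auxE i j k))]
  simp_rw [auxF_integral]
  have h : ∀ k, Real.Gamma (1 / 2 + (auxE i j k : ℝ)) = √Real.pi *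
      (if auxE i j k = 0 then 1 else if auxE i j k = 1 then 1 / 2 else 3 / 4) :=
    fun k => auxGamma _ (by unfold auxE; split_ifs <;> norm_num)
  simp_rw [h, Finset.prod_mul_distrib]
  simp only [Finset.prod_const, Finset.card_univ, Fintype.card_fin]
  congr 1
  by_cases hij : i = j
  · subst hij
    rw [Finset.prod_eq_single i]
    · simp [auxE]; norm_num
    · intro b _ hb; simp [auxE, hb]
    · simp
  · rw [Finset.prod_eq_mul i j hij]
    · simp [auxE, hij, Ne.symm hij]; norm_num
    · intro b _ hb; simp [auxE, hb.1, hb.2]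
    · simp
    · simp

lemma auxK_eq {n : ℕ} (c t : Fin n → ℝ) :
    (∑ i, c i / t i) ^ 2 * ∏ k, auxF 0 (t k)
      = ∑ i, ∑ j, c i * c j * ∏ k, auxF (auxE i j k) (t k) := by
  rw [sq, Finset.sum_mul_sum, Finset.sum_mul]
  refine Finset.sum_congr rfl fun i _ => ?_
  rw [Finset.sum_mul]
  refine Finset.sum_congr rfl fun j _ => ?_
  rw [auxE_prod]
  ring

lemma auxE_integrable {n : ℕ} (i j : Fin n) :
    Integrable fun t : Fin n → ℝ => ∏ k, auxF (auxE i j k) (t k) :=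
  Integrable.fintype_prod (f := fun k => auxF (auxE i j k)) fun k => auxF_int _

lemma auxK_integrable {n : ℕ} (c : Fin n → ℝ) :
    Integrable fun t : Fin n → ℝ => (∑ i, c i / t i) ^ 2 * ∏ k, auxF 0 (t k) := by
  simp_rw [auxK_eq]
  exact integrable_finsetSum _ fun i _ => integrable_finsetSum _ fun j _ =>
    (auxE_integrable i j).const_mul _

lemma auxK_integral {n : ℕ} (c : Fin n → ℝ) (hc : ∑ i, c i = 0) :
    ∫ t : Fin n → ℝ, (∑ i, c i / t i) ^ 2 * ∏ k, auxF 0 (t k)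
      = √Real.pi ^ n * (1 / 2 * ∑ i, c i ^ 2) := by
  simp_rw [auxK_eq]
  rw [integral_finsetSum _ fun i _ => integrable_finsetSum _ fun j _ =>
    (auxE_integrable i j).const_mul _]
  have h : ∀ i, ∫ t : Fin n → ℝ, ∑ j, c i * c j * ∏ k, auxF (auxE i j k) (t k)
      = √Real.pi ^ n * (1 / 2 * c i ^ 2) := by
    intro i
    rw [integral_finsetSum _ fun j _ => (auxE_integrable i j).const_mul _]
    simp_rw [integral_const_mul, auxE_integral]
    have h2 : ∀ j, c i * c j * (√Real.pi ^ n * (1 / 4 + if i = j then 1 / 2 else 0))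
        = √Real.pi ^ n * c i / 4 * c j + (if i = j then √Real.pi ^ n * (1 / 2 * (c i * c j)) else 0) := by
      intro j; split_ifs <;> ring
    simp_rw [h2, Finset.sum_add_distrib, ← Finset.mul_sum, hc]
    rw [Finset.sum_ite_eq, if_pos (Finset.mem_univ i)]
    ring
  simp_rw [h, ← Finset.mul_sum]

noncomputable def auxg (d : ℕ) (c t : Fin (d + 1) → ℝ) : ℝ :=
  ((∑ i, c i / t i) / (∑ i, 1 / t i)) ^ 2 *
    ((∏ k, t k ^ (-(3 : ℝ) / 2)) / (∑ i, 1 / t i) ^ (((d : ℝ) + 1) / 2))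

noncomputable def auxG (d : ℕ) (c : Fin (d + 1) → ℝ) : (Fin (d + 1) → ℝ) → ℝ≥0∞ :=
  {t | ∀ i, 0 < t i}.indicator fun t => ENNReal.ofReal (auxg d c t)

lemma auxP_meas (n : ℕ) : MeasurableSet {t : Fin n → ℝ | ∀ i, 0 < t i} := by
  rw [Set.ofPred_forall]
  exact MeasurableSet.iInter fun i => measurableSet_lt measurable_const (measurable_pi_apply i)

lemma auxG_meas (d : ℕ) (c : Fin (d + 1) → ℝ) : Measurable (auxG d c) := by
  refine Measurable.indicator ?_ (auxP_meas _)
  unfold auxg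
  fun_prop

lemma auxG_zero (d : ℕ) (c : Fin (d + 1) → ℝ) (t : Fin (d + 1) → ℝ) (h : ∃ i, t i ≤ 0) :
    auxG d c t = 0 := by
  obtain ⟨i, hi⟩ := h
  exact indicator_of_notMem (fun h : ∀ i, 0 < t i => absurd (h i) (not_lt.2 hi)) _

lemma auxG_hom (d : ℕ) (c : Fin (d + 1) → ℝ) (r : ℝ) (hr : 0 < r) (t : Fin (d + 1) → ℝ) :
    ENNReal.ofReal (r ^ d) * auxG d c (r • t) = ENNReal.ofReal r⁻¹ * auxG d c t := by
  by_cases ht : ∀ i, 0 < t i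
  · have ht' : ∀ i, 0 < (r • t) i := fun i => by simpa using mul_pos hr (ht i)
    unfold auxG
    rw [indicator_of_mem (by exact ht'), indicator_of_mem (by exact ht),
      ← ENNReal.ofReal_mul (by positivity), ← ENNReal.ofReal_mul (by positivity)]
    congr 1
    unfold auxg
    have hSpos : 0 < ∑ i, 1 / t i :=
      Finset.sum_pos (fun i _ => by have := ht i; positivity) Finset.univ_nonempty
    have e : ∀ c : Fin (d + 1) → ℝ, ∑ i, c i / (r • t) i = (∑ i, c i / t i) / r := by
      intro c
      rw [Finset.sum_div]
      exact Finset.sum_congr rfl fun i _ => by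
        rw [Pi.smul_apply, smul_eq_mul, div_div, mul_comm]
    have e2 : ∏ k, (r • t) k ^ (-(3 : ℝ) / 2)
        = (r ^ (((d : ℝ) + 1) / 2))⁻¹ * r⁻¹ * (r ^ d)⁻¹ * ∏ k, t k ^ (-(3 : ℝ) / 2) := by
      have : ∀ k, (r • t) k ^ (-(3 : ℝ) / 2) = r ^ (-(3 : ℝ) / 2) * t k ^ (-(3 : ℝ) / 2) := by
        intro k
        rw [Pi.smul_apply, smul_eq_mul, Real.mul_rpow hr.le (ht k).le]
      simp_rw [this, Finset.prod_mul_distrib]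
      congr 1
      simp only [Finset.prod_const, Finset.card_univ, Fintype.card_fin]
      rw [← Real.rpow_mul_natCast hr.le, ← Real.rpow_natCast r d, ← Real.rpow_neg hr.le,
        ← Real.rpow_neg hr.le, ← Real.rpow_neg_one, ← Real.rpow_add hr, ← Real.rpow_add hr]
      congr 1
      push_cast
      ring
    rw [e, e (fun _ => 1), e2, Real.div_rpow hSpos.le hr.le]
    have : 0 < (∑ i, 1 / t i) ^ (((d : ℝ) + 1) / 2) := by positivity
    have : 0 < r ^ (((d : ℝ) + 1) / 2) := by positivity
    field_simp
  · have ht' : ¬ ∀ i, 0 < (r • t) i := fun h => ht fun i => by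
      have := h i
      simp only [Pi.smul_apply, smul_eq_mul] at this
      exact (mul_pos_iff_of_pos_left hr).1 this
    push Not at ht ht'
    rw [auxG_zero d c _ ht, auxG_zero d c _ ht', mul_zero, mul_zero]

lemma auxG_K (d : ℕ) (c t : Fin (d + 1) → ℝ) :
    auxG d c t * ENNReal.ofReal ((∑ i, 1 / t i) ^ (((d : ℝ) + 1) / 2 + 2) *
      Real.exp (-(∑ i, 1 / t i)))
    = ENNReal.ofReal ((∑ i, c i / t i) ^ 2 * ∏ k, auxF 0 (t k)) := by
  by_cases ht : ∀ i, 0 < t i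
  · unfold auxG
    rw [indicator_of_mem (by exact ht)]
    have hSpos : 0 < ∑ i, 1 / t i :=
      Finset.sum_pos (fun i _ => by have := ht i; positivity) Finset.univ_nonempty
    rw [← ENNReal.ofReal_mul' (by positivity)]
    congr 1
    unfold auxg
    have e : ∏ k, auxF 0 (t k) = (∏ k, t k ^ (-(3 : ℝ) / 2)) * Real.exp (-(∑ i, 1 / t i)) := by
      rw [← Finset.sum_neg_distrib, Real.exp_sum, ← Finset.prod_mul_distrib]
      refine Finset.prod_congr rfl fun k _ => ?_
      unfold auxF
      rw [indicator_of_mem (by exact ht k)]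
      norm_num
    rw [e, Real.rpow_add hSpos]
    have : 0 < (∑ i, 1 / t i) ^ (((d : ℝ) + 1) / 2) := by positivity
    rw [show (∑ i, 1 / t i) ^ (2:ℝ) = (∑ i, 1 / t i) ^ 2 from Real.rpow_natCast _ 2]
    generalize (∑ i, 1 / t i) ^ (((d : ℝ) + 1) / 2) = A at *
    generalize (∑ i, 1 / t i) = B at *
    field_simp
  · push Not at ht
    rw [auxG_zero d c t ht]
    obtain ⟨i, hi⟩ := ht
    rw [Finset.prod_eq_zero (Finset.mem_univ i)]
    · simp
    · exact indicator_of_notMem (by simpa using hi) _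

lemma auxJ (d : ℕ) (c : Fin (d + 1) → ℝ) (hc : ∑ i, c i = 0) :
    Real.Gamma (((d : ℝ) + 1) / 2 + 2) * (∫⁻ x, auxG d c (extCoord x)).toReal
      = √Real.pi ^ (d + 1) * (1 / 2 * ∑ i, c i ^ 2) := by
  have h := aux_polar d (auxG d c) (auxG_meas d c) (auxG_zero d c) (auxG_hom d c)
    (((d : ℝ) + 1) / 2 + 2) (by positivity)
  simp_rw [auxG_K] at h
  rw [← ofReal_integral_eq_lintegral_ofReal (auxK_integrable c), auxK_integral c hc] at h
  · have h' := congrArg ENNReal.toReal h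
    rw [ENNReal.toReal_mul, ENNReal.toReal_ofReal (by positivity), ENNReal.toReal_ofReal
      (Real.Gamma_pos_of_pos (by positivity)).le] at h'
    exact h'.symm
  · refine Filter.Eventually.of_forall fun t => ?_
    exact mul_nonneg (sq_nonneg _) (Finset.prod_nonneg fun k _ => auxF_nonneg _ _)

lemma auxJ_fin (d : ℕ) (c : Fin (d + 1) → ℝ) : ∀ᵐ x, auxG d c (extCoord x) < ∞ := by
  refine Filter.Eventually.of_forall fun x => ?_
  unfold auxG indicator
  split_ifs <;> simp

noncomputable def auxc (d p : ℕ) (i : Fin (d + 1)) : ℝ :=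
  ((d : ℝ) + 1) * (if (i : ℕ) < p then 1 else 0) - p

lemma auxcard (d p : ℕ) (hpd : p ≤ d) : ∑ i : Fin (d + 1), (if (i : ℕ) < p then (1:ℝ) else 0) = p := by
  rw [Fin.sum_univ_eq_sum_range (fun i => if i < p then (1:ℝ) else 0), ← Finset.sum_filter]
  have : (Finset.range (d + 1)).filter (fun i => i < p) = Finset.range p := by
    ext i; simp; omega
  rw [this]; simp

lemma auxc_sum (d p : ℕ) (hpd : p ≤ d) : ∑ i, auxc d p i = 0 := by
  unfold auxc
  rw [Finset.sum_sub_distrib, ← Finset.mul_sum, auxcard d p hpd]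
  simp

lemma auxc_sum_sq (d p : ℕ) (hpd : p ≤ d) :
    ∑ i, auxc d p i ^ 2 = p * ((d : ℝ) + 1 - p) * (d + 1) := by
  have h : ∀ i : Fin (d + 1), auxc d p i ^ 2
      = (((d : ℝ) + 1) ^ 2 - 2 * p * (d + 1)) * (if (i : ℕ) < p then (1:ℝ) else 0) + p ^ 2 := by
    intro i; unfold auxc; split_ifs <;> ring
  simp_rw [h, Finset.sum_add_distrib, ← Finset.mul_sum, auxcard d p hpd]
  simp
  ring

lemma auxY (d p : ℕ) (hpd : p ≤ d) (x : Fin d → ℝ) (hx : ∀ i, 0 < extCoord x i) :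
    (-(p : ℝ) + ((d : ℝ) + 1) *
            ∑ i ∈ Finset.univ.filter (fun i : Fin d => (i : ℕ) < p),
              (1 / x i) / (∑ k, 1 / extCoord x k))
    = (∑ i, auxc d p i / extCoord x i) / (∑ k, 1 / extCoord x k) := by
  have hSpos : 0 < ∑ i, 1 / extCoord x i :=
    Finset.sum_pos (fun i _ => by have := hx i; positivity) Finset.univ_nonempty
  have h : ∑ i, auxc d p i / extCoord x i
      = ((d : ℝ) + 1) * (∑ i ∈ Finset.univ.filter (fun i : Fin d => (i : ℕ) < p), 1 / x i)
        - p * ∑ k, 1 / extCoord x k := by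
    have h1 : ∀ i, auxc d p i / extCoord x i = ((d : ℝ) + 1) *
        (if (i : ℕ) < p then 1 / extCoord x i else 0) - p * (1 / extCoord x i) := by
      intro i; unfold auxc; split_ifs <;> ring
    simp_rw [h1, Finset.sum_sub_distrib, ← Finset.mul_sum]
    congr 2
    rw [Fin.sum_univ_castSucc, Finset.sum_filter]
    simp [extCoord, not_lt.2 hpd]
  rw [h, ← Finset.sum_div]
  field_simp
  ring

lemma auxRho (d : ℕ) (x : Fin d → ℝ) (hx : ∀ i, 0 < extCoord x i) :
    rhoD d 0 (fun _ => 1 / ((d : ℝ) + 1)) x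
      = Real.Gamma (((d : ℝ) + 1) / 2) / √Real.pi ^ (d + 1) *
        ((∏ k, extCoord x k ^ (-(3 : ℝ) / 2)) /
          (∑ i, 1 / extCoord x i) ^ (((d : ℝ) + 1) / 2)) := by
  have hSpos : 0 < ∑ i, 1 / extCoord x i :=
    Finset.sum_pos (fun i _ => by have := hx i; positivity) Finset.univ_nonempty
  have hn : (0:ℝ) < 1 / ((d : ℝ) + 1) := by positivity
  unfold rhoD
  have h1 : ∑ j, (1 / ((d : ℝ) + 1)) ^ 2 / extCoord x j
      = (1 / ((d : ℝ) + 1)) ^ 2 * ∑ j, 1 / extCoord x j := by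
    rw [Finset.mul_sum]
    exact Finset.sum_congr rfl fun i _ => by ring
  have h2 : ((1 / ((d : ℝ) + 1)) ^ 2) ^ (((d : ℝ) + 1) / 2) = (1 / ((d : ℝ) + 1)) ^ (d + 1) := by
    rw [← Real.rpow_natCast, ← Real.rpow_mul hn.le, ← Real.rpow_natCast]
    congr 1
    push_cast
    ring
  have h3 : Real.pi ^ ((d : ℝ) / 2) = √Real.pi ^ d := by
    rw [Real.sqrt_eq_rpow, ← Real.rpow_natCast, ← Real.rpow_mul Real.pi_pos.le]
    congr 1
    ring
  rw [h1, zero_add, zero_add, Real.mul_rpow (by positivity) hSpos.le, h2, h3,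
    Real.Gamma_one_half_eq]
  simp only [Finset.prod_const, Finset.card_univ, Fintype.card_fin]
  have : 0 < (∑ i, 1 / extCoord x i) ^ (((d : ℝ) + 1) / 2) := by positivity
  have : 0 < (1 / ((d : ℝ) + 1)) ^ (d + 1) := by positivity
  have : 0 < √Real.pi := by have := Real.pi_pos; positivity
  generalize (∑ i, 1 / extCoord x i) ^ (((d : ℝ) + 1) / 2) = A at *
  generalize (1 / ((d : ℝ) + 1)) ^ (d + 1) = B at *
  field_simp
  ring

lemma aux_mem (d : ℕ) (x : Fin d → ℝ) : x ∈ simplexDelta d ↔ ∀ i, 0 ≤ extCoord x i := by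
  constructor
  · rintro ⟨h1, h2⟩ i
    refine Fin.lastCases ?_ (fun j => ?_) i
    · simpa [extCoord] using h2
    · simpa [extCoord] using h1 j
  · intro h
    refine ⟨fun i => ?_, ?_⟩
    · simpa [extCoord] using h i.castSucc
    · simpa [extCoord] using h (Fin.last d)

lemma aux_simplex_meas (d : ℕ) : MeasurableSet (simplexDelta d) := by
  have : simplexDelta d = ⋂ i, {x | 0 ≤ extCoord x i} := by
    ext x; simp [aux_mem]
  rw [this]
  exact MeasurableSet.iInter fun i => measurableSet_le measurable_const
    ((measurable_pi_apply i).comp (aux_meas_extCoord d))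

/-- With uniform weights `p_i = 1/(d+1)`, the random variable
`Y_p = −p + (d+1) Σ_{i=1}^p (1/x_i)/(Σ_{k=1}^{d+1} 1/x_k)` satisfies
`∫_{Δ_d} Y_p² ρ_d dx = 2p(d+1−p)/(d+3)` for each `1 ≤ p ≤ d`. -/
theorem Yp_second_moment (d p : ℕ) (hp1 : 1 ≤ p) (hpd : p ≤ d) :
    ∫ x in simplexDelta d,
        (-(p : ℝ) + ((d : ℝ) + 1) *
            ∑ i ∈ Finset.univ.filter (fun i : Fin d => (i : ℕ) < p),
              (1 / x i) / (∑ k, 1 / extCoord x k)) ^ 2 *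
          rhoD d 0 (fun _ => 1 / ((d : ℝ) + 1)) x
      = 2 * (p : ℝ) * ((d : ℝ) + 1 - (p : ℝ)) / ((d : ℝ) + 3) := by
  rw [← integral_indicator (aux_simplex_meas d)]
  set C : ℝ := Real.Gamma (((d : ℝ) + 1) / 2) / √Real.pi ^ (d + 1) with hC
  have hpt : ∀ x : Fin d → ℝ, (simplexDelta d).indicator (fun x =>
      (-(p : ℝ) + ((d : ℝ) + 1) *
            ∑ i ∈ Finset.univ.filter (fun i : Fin d => (i : ℕ) < p),
              (1 / x i) / (∑ k, 1 / extCoord x k)) ^ 2 *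
          rhoD d 0 (fun _ => 1 / ((d : ℝ) + 1)) x) x
      = C * (auxG d (auxc d p) (extCoord x)).toReal := by
    intro x
    by_cases hx : ∀ i, 0 < extCoord x i
    · rw [indicator_of_mem ((aux_mem d x).2 fun i => (hx i).le), auxY d p hpd x hx, auxRho d x hx]
      unfold auxG
      rw [indicator_of_mem (by exact hx)]
      have hSpos : 0 < ∑ i, 1 / extCoord x i :=
        Finset.sum_pos (fun i _ => by have := hx i; positivity) Finset.univ_nonempty
      rw [ENNReal.toReal_ofReal]
      · unfold auxg
        ring
      · unfold auxg
        have : 0 ≤ ∏ k, extCoord x k ^ (-(3 : ℝ) / 2) :=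
          Finset.prod_nonneg fun k _ => Real.rpow_nonneg (hx k).le _
        positivity
    · push Not at hx
      rw [auxG_zero d _ _ hx, ENNReal.toReal_zero, mul_zero]
      by_cases hm : x ∈ simplexDelta d
      · rw [indicator_of_mem hm]
        obtain ⟨i, hi⟩ := hx
        have h0 : extCoord x i = 0 := le_antisymm hi ((aux_mem d x).1 hm i)
        unfold rhoD
        rw [Finset.prod_eq_zero (f := fun j => extCoord x j ^ (-(3 : ℝ) / 2)) (Finset.mem_univ i)
          (by rw [h0, Real.zero_rpow (by norm_num)])]
        simp
      · rw [indicator_of_notMem hm]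
  simp_rw [hpt]
  rw [integral_const_mul, integral_toReal (f := fun x => auxG d (auxc d p) (extCoord x))
    ((auxG_meas d _).comp (aux_meas_extCoord d)).aemeasurable (auxJ_fin d _)]
  have hJ := auxJ d (auxc d p) (auxc_sum d p hpd)
  rw [auxc_sum_sq d p hpd, show ((d : ℝ) + 1) / 2 + 2 = (((d : ℝ) + 1) / 2 + 1) + 1 by ring,
    Real.Gamma_add_one (by positivity), Real.Gamma_add_one (by positivity)] at hJ
  have hg : 0 < Real.Gamma (((d : ℝ) + 1) / 2) := Real.Gamma_pos_of_pos (by positivity)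
  have hpi : 0 < √Real.pi ^ (d + 1) := by have := Real.pi_pos; positivity
  have hd : (0:ℝ) < (d : ℝ) + 1 := by positivity
  have hd3 : (0:ℝ) < (d : ℝ) + 3 := by positivity
  rw [hC]
  generalize (∫⁻ x, auxG d (auxc d p) (extCoord x)).toReal = J at *
  generalize Real.Gamma (((d : ℝ) + 1) / 2) = A at *
  generalize √Real.pi ^ (d + 1) = B at *
  rw [div_mul_eq_mul_div, div_eq_div_iff hpi.ne' hd3.ne']
  apply mul_left_cancel₀ hd.ne'
  linear_combination 4 * hJ
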